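/- There is no 3-cycle γ of (R₇, ℤ×R₇) satisfying l(γ) = 7 such that all generators occurring in γ have the same degree (i.e., l(γ) = |T_n(γ)| = 7 where n is the minimal degree of γ). -/

import Mathlib

namespace QHom

variable {X S : Type*}

/-- Generating tuples: an element of `S` together with a list of quandle elements
whose consecutive entries are distinct. -/
abbrev Gen (X S : Type*) := {p : S × List X // p.2.Chain' (· ≠ ·)}

/-- The chain group: the free abelian group on `Gen X S`. -/
abbrev Ch (X S : Type*) := Gen X S →₀ ℤ

/-- The basis chain associated to a tuple; `0` if two consecutive entries coincide. -/
noncomputable def gen (s : S) (l : List X) : Ch X S := by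
  classical
  exact if h : l.Chain' (· ≠ ·) then Finsupp.single ⟨(s, l), h⟩ 1 else 0

noncomputable def fOn (t : Gen X S) : Ch X S :=
  ∑ j : Fin t.1.2.length, ((-1 : ℤ) ^ ((j : ℕ) + 1)) • gen t.1.1 (t.1.2.eraseIdx (j : ℕ))

/-- The map `f`. -/
noncomputable def fmap (γ : Ch X S) : Ch X S := γ.sum fun t c => c • fOn t

noncomputable def gOn (op : X → X → X) (sact : S → X → S) (t : Gen X S) : Ch X S :=
  ∑ j : Fin t.1.2.length,
    ((-1 : ℤ) ^ (j : ℕ)) •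
      gen (sact t.1.1 (t.1.2.get j))
        ((t.1.2.take (j : ℕ)).map (fun x => op x (t.1.2.get j)) ++ t.1.2.drop ((j : ℕ) + 1))

/-- The map `g`. -/
noncomputable def gmap (op : X → X → X) (sact : S → X → S) (γ : Ch X S) : Ch X S :=
  γ.sum fun t c => c • gOn op sact t

/-- The boundary map `∂ = f + g`. -/
noncomputable def bd (op : X → X → X) (sact : S → X → S) (γ : Ch X S) : Ch X S :=
  fmap γ + gmap op sact γ

/-- `γ` is an `m`-chain: it is supported on tuples of length `m`. -/
def IsMChain (m : ℕ) (γ : Ch X S) : Prop := ∀ t ∈ γ.support, t.1.2.length = m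

/-- The length of a chain: the sum of the absolute values of its coefficients. -/
noncomputable def chainLen (γ : Ch X S) : ℕ := γ.sum fun _ c => c.natAbs

/-- `π` : forget the `S`-coordinate. -/
noncomputable def proj (γ : Ch X S) : Ch X Unit := γ.sum fun t c => c • gen () t.1.2

/-- Evaluation of a cochain (given by its values on generating tuples) on a chain. -/
noncomputable def evalCh {A : Type*} [AddCommGroup A] (θ : List X → A) (δ : Ch X Unit) : A :=
  δ.sum fun t c => c • θ t.1.2

/-- The action of quandle generators on the `X`-set `ℤ × X`. -/
def zact (op : X → X → X) (s : ℤ × X) (a : X) : ℤ × X := (s.1 + 1, op s.2 a)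

/-- `γ` is a 3-term of degree `n` and index `u`. -/
def IsTerm3 (γ : Ch X (ℤ × X)) (n : ℤ) (u : X) : Prop :=
  ∃ ε a b c, (ε = (1 : ℤ) ∨ ε = -1) ∧ a ≠ b ∧ b ≠ c ∧ γ = ε • gen (n, u) [a, b, c]

def Efficient {k : ℕ} (γ : Fin k → Ch X S) : Prop := ∀ i j, i ≠ j → γ i ≠ -γ j

def FConnected {k : ℕ} (γ : Fin k → Ch X S) : Prop :=
  Efficient γ ∧ (∑ i, fmap (γ i)) = 0 ∧
    ∀ I : Finset (Fin k), I.Nonempty → I ≠ Finset.univ → (∑ i ∈ I, fmap (γ i)) ≠ 0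

def GConnected {k : ℕ} (op : X → X → X) (sact : S → X → S) (γ : Fin k → Ch X S) : Prop :=
  Efficient γ ∧ (∑ i, gmap op sact (γ i)) = 0 ∧
    ∀ I : Finset (Fin k), I.Nonempty → I ≠ Finset.univ → (∑ i ∈ I, gmap op sact (γ i)) ≠ 0

/-- `n` is the minimal degree of `γ`. -/
def MinDegree (γ : Ch X (ℤ × X)) (n : ℤ) : Prop :=
  (∃ t ∈ γ.support, t.1.1.1 = n) ∧ ∀ t ∈ γ.support, n ≤ t.1.1.1

/-- `|T_k(γ)|`: the number of terms (with multiplicity) of `γ` of degree `k`. -/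
noncomputable def Tcount (γ : Ch X (ℤ × X)) (k : ℤ) : ℕ :=
  γ.sum fun t c => if t.1.1.1 = k then c.natAbs else 0

def revList (op : X → X → X) : List X → List X
  | [] => []
  | a :: l => l.foldl op a :: revList op l

/-- The reverse of a chain of `(X, ℤ × X)` (a chain of the dual quandle). -/
noncomputable def reverse (op : X → X → X) (γ : Ch X (ℤ × X)) : Ch X (ℤ × X) :=
  γ.sum fun t c => c • gen (-t.1.1.1, t.1.2.foldl op t.1.1.2) (revList op t.1.2)

/-- The degree-shift automorphism `σ`. -/
noncomputable def sigmaMap (γ : Ch X (ℤ × X)) : Ch X (ℤ × X) :=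
  γ.sum fun t c => c • gen (t.1.1.1 + 1, t.1.1.2) t.1.2

/-- `γ` is a 3-term of type `ty` with respect to the operation `op`. -/
def IsTypedTerm (op : X → X → X) (γ : Ch X (ℤ × X)) (ty : ℕ) : Prop :=
  ∃ (ε n : ℤ) (u a b c : X), (ε = 1 ∨ ε = -1) ∧ a ≠ b ∧ b ≠ c ∧
    γ = ε • gen (n, u) [a, b, c] ∧
    ((ty = 0 ∧ a = c ∧ op a b = c) ∨ (ty = 1 ∧ a = c ∧ op a b ≠ c) ∨
      (ty = 2 ∧ a ≠ c ∧ op a b = c) ∨ (ty = 3 ∧ a ≠ c ∧ op a b ≠ c))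

/-- A bigon 3-term `⟨x, y⟩` of degree `n` and index `u`. -/
def IsBigon (n : ℤ) (u x y : X) (δ : Ch X (ℤ × X)) : Prop :=
  δ = gen (n, u) [x, y, x] ∨ δ = gen (n, u) [y, x, y]

/-- The case shapes (A), (B), (C). -/
def Shape (δ : Ch X (ℤ × X)) (n : ℤ) (l : ℕ) : Prop :=
  (4 ≤ l ∧ l ≤ 7 ∧ Tcount δ n = l) ∨
  (6 ≤ l ∧ l ≤ 7 ∧ Tcount δ n = 2 ∧ Tcount δ (n + 1) = l - 2) ∨
  (6 ≤ l ∧ l ≤ 7 ∧ Tcount δ n = 3 ∧ Tcount δ (n + 1) = l - 3)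

/-- A quandle structure on `X`. -/
structure QuandleStr (X : Type*) where
  op : X → X → X
  idem : ∀ a, op a a = a
  bij : ∀ b, Function.Bijective fun a => op a b
  dist : ∀ a b c, op (op a b) c = op (op a c) (op b c)

/-- The dual quandle operation. -/
noncomputable def dualOp (Q : QuandleStr X) : X → X → X :=
  fun a b => (Equiv.ofBijective (fun x => Q.op x b) (Q.bij b)).symm a

/-- An `X`-set: a set with a right action of the associated group `G(X)`, recorded via its
action of the generators, which is bijective generator-wise and compatible with the
defining relations of `G(X)`. -/
structure QSet (X : Type*) (op : X → X → X) (S : Type*) where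
  sact : S → X → S
  bij : ∀ a, Function.Bijective fun s => sact s a
  comm : ∀ s a b, sact (sact s a) b = sact (sact s b) (op a b)

/-- The 7-dihedral quandle operation on `ZMod 7`. -/
def R7op : ZMod 7 → ZMod 7 → ZMod 7 := fun a b => 2 * b - a

def zetaInt (a b c : ℤ) : ℤ := (a - b) * ((b ^ 7 + (2 * c - b) ^ 7 - 2 * c ^ 7) / 7)

/-- The Mochizuki 3-cocycle on triples. -/
def zetaFun (a b c : ZMod 7) : ZMod 7 := (zetaInt a.val b.val c.val : ℤ)

def zetaL : List (ZMod 7) → ZMod 7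
  | [a, b, c] => zetaFun a b c
  | _ => 0

/-- The octahedral quandle operation on `Fin 6`: `octAct a b = σ_b(a)`. -/
def octAct : Fin 6 → Fin 6 → Fin 6 := fun a b =>
  ![![0, 2, 4, 3, 5, 1],
    ![5, 1, 0, 2, 4, 3],
    ![1, 3, 2, 4, 0, 5],
    ![0, 5, 1, 3, 2, 4],
    ![2, 1, 3, 5, 4, 0],
    ![4, 0, 2, 1, 3, 5]] b a

/-- `σ₀`, the rotation about the axis through `0` and `3`. -/
def sig0 : Fin 6 → Fin 6 := fun a => octAct a 0

def etaTriples1 : List (Fin 6 × Fin 6 × Fin 6) :=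
  [(0, 1, 2), (0, 3, 1), (1, 2, 0), (1, 4, 2), (3, 1, 5)]

def etaTriples2 : List (Fin 6 × Fin 6 × Fin 6) :=
  [(0, 1, 5), (1, 0, 1), (1, 0, 5), (1, 2, 1), (1, 3, 1), (1, 3, 2), (1, 4, 5), (1, 5, 1),
    (3, 0, 1), (3, 1, 0), (3, 1, 2)]

/-- The 3-cocycle `η` of the octahedral quandle, on triples. -/
noncomputable def etaFun (a b c : Fin 6) : ZMod 3 := by
  classical
  exact
    if ∃ k : ℕ, ∃ p ∈ etaTriples1, a = sig0^[k] p.1 ∧ b = sig0^[k] p.2.1 ∧ c = sig0^[k] p.2.2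
      then 1
    else if ∃ k : ℕ, ∃ p ∈ etaTriples2, a = sig0^[k] p.1 ∧ b = sig0^[k] p.2.1 ∧ c = sig0^[k] p.2.2
      then 2
    else 0

noncomputable def etaL : List (Fin 6) → ZMod 3
  | [a, b, c] => etaFun a b c
  | _ => 0

/-- The bit that represents the edge `(x, y)` in the block `g`; no bit for a degenerate edge. -/
def edgeMask (g x y : ℕ) : ℕ := bif Nat.beq x y then 0 else 1 <<< (49 * g + 7 * x + y)

/-- The boundary modulo 2 of the triangle `(x, y, z)` in the block `g`. -/
def triMask (g x y z : ℕ) : ℕ := edgeMask g x y ^^^ edgeMask g x z ^^^ edgeMask g y z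

/-- The index of the triangle that carries the `g`-boundary of `(u; a, b, c)`. -/
def dual0 (u a b c : ℕ) : ℕ := (6 * u + 2 * a + 5 * b + 2 * c) % 7

/-- The first vertex of the triangle that carries the `g`-boundary of `(u; a, b, c)`. -/
def dual1 (a b c : ℕ) : ℕ := (a + 5 * b + 2 * c) % 7

/-- The second vertex of the triangle that carries the `g`-boundary of `(u; a, b, c)`;
the third vertex is `c`. -/
def dual2 (b c : ℕ) : ℕ := (6 * b + 2 * c) % 7

/-- The boundary modulo 2 of `(u; a, b, c)`: blocks `0, …, 6` hold the `f`-part and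
blocks `7, …, 13` the `g`-part. -/
def termMask (u a b c : ℕ) : ℕ :=
  triMask u a b c ^^^ triMask (7 + dual0 u a b c) (dual1 a b c) (dual2 b c) c

/-- The mask of the term whose boundary in the block `g` is the triangle `(x, y, z)`. -/
def blockMask (g x y z : ℕ) : ℕ :=
  bif Nat.ble 7 g then termMask (dual0 (g - 7) x y z) (dual1 x y z) (dual2 y z) z
  else termMask g x y z

/-- `P` holds for the masks of all terms whose boundary contains the edge `(x, y)` in the
block `g` and whose third vertex there is less than the last argument. -/
def allBranches (P : ℕ → Bool) (g x y : ℕ) : ℕ → Bool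
  | 0 => true
  | z + 1 =>
    (Nat.beq y z || P (blockMask g x y z)) && (Nat.beq x z || P (blockMask g z x y)) &&
      (Nat.beq x z || Nat.beq z y || P (blockMask g x z y)) && allBranches P g x y z

/-- The block `g` of `m`, made of `49` bits. -/
def block (g m : ℕ) : ℕ := (m >>> (49 * g)) % 562949953421312

/-- Clear the lowest bit that is set. -/
def dropBit (m : ℕ) : ℕ := m &&& (m - 1)

/-- A lower bound for the number of unused terms needed to produce `p` in the block `g`. -/
def weight (used : List ℕ) (g p : ℕ) : ℕ :=
  bif Nat.beq p 0 then 0 else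
  bif Nat.beq (dropBit (dropBit p)) 0 then 1 else
  bif Nat.beq (dropBit (dropBit (dropBit p))) 0 &&
    !(used.any fun μ => Nat.beq (block g μ) p) then 1 else 2

/-- The sum of the lower bounds `weight` over consecutive blocks of `m`. -/
def load (used : List ℕ) (m off : ℕ) : ℕ → ℕ
  | 0 => 0
  | n + 1 => weight used (off + n) (block (off + n) m) + load used m off n

/-- If `search r m used` is true then `m` is not a sum modulo 2 of at most `r` unused masks. -/
def search : ℕ → ℕ → List ℕ → Bool
  | 0, m, _ => !(Nat.beq m 0)
  | r + 1, m, used =>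
    !(Nat.beq m 0) &&
    (!(Nat.ble (load used m 0 7) (r + 1)) || !(Nat.ble (load used m 7 7) (r + 1)) ||
      allBranches (fun μ => used.any (Nat.beq μ) || search r (m ^^^ μ) (μ :: used))
        (Nat.log2 m / 49) (Nat.log2 m / 7 % 7) (Nat.log2 m % 7) 7)

theorem natBeq_eq_false {x y : ℕ} : Nat.beq x y = false ↔ x ≠ y := by
  rw [← Bool.not_eq_true, Nat.beq_eq]

theorem testBit_edgeMask (g x y k : ℕ) :
    (edgeMask g x y).testBit k = decide (x ≠ y ∧ k = 49 * g + 7 * x + y) := by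
  unfold edgeMask
  by_cases h : x = y
  · simp [h]
  · rw [natBeq_eq_false.2 h, cond_false, Nat.one_shiftLeft, Nat.testBit_two_pow, decide_eq_decide]
    simp [h, eq_comm]

theorem edge_of_testBit_triMask {g x y z k : ℕ} (h : (triMask g x y z).testBit k = true) :
    x ≠ y ∧ k = 49 * g + 7 * x + y ∨ x ≠ z ∧ k = 49 * g + 7 * x + z ∨
      y ≠ z ∧ k = 49 * g + 7 * y + z := by
  by_contra hn
  push Not at hn
  simp only [triMask, Nat.testBit_xor, testBit_edgeMask] at h
  rw [decide_eq_false (by tauto), decide_eq_false (by tauto), decide_eq_false (by tauto)] at h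
  simp at h

theorem testBit_block (g m j : ℕ) :
    (block g m).testBit j = (decide (j < 49) && m.testBit (49 * g + j)) := by
  rw [block, show 562949953421312 = 2 ^ 49 from rfl, Nat.testBit_mod_two_pow,
    Nat.testBit_shiftRight]

theorem block_xor (g m n : ℕ) : block g (m ^^^ n) = block g m ^^^ block g n := by
  apply Nat.eq_of_testBit_eq
  intro j
  by_cases hj : j < 49 <;> simp [testBit_block, hj]

theorem block_edgeMask_self {x y : ℕ} (g : ℕ) (hx : x < 7) (hy : y < 7) :
    block g (edgeMask g x y) = edgeMask 0 x y := by
  apply Nat.eq_of_testBit_eq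
  intro j
  rw [testBit_block, testBit_edgeMask, testBit_edgeMask, ← Bool.decide_and, decide_eq_decide]
  omega

theorem block_edgeMask_of_ne {g h x y : ℕ} (hx : x < 7) (hy : y < 7) (hgh : g ≠ h) :
    block g (edgeMask h x y) = 0 := by
  apply Nat.eq_of_testBit_eq
  intro j
  rw [testBit_block, testBit_edgeMask, ← Bool.decide_and, Nat.zero_testBit, decide_eq_false_iff_not]
  omega

theorem block_triMask_self {x y z : ℕ} (g : ℕ) (hx : x < 7) (hy : y < 7) (hz : z < 7) :
    block g (triMask g x y z) = triMask 0 x y z := by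
  simp only [triMask, block_xor, block_edgeMask_self, hx, hy, hz]

theorem block_triMask_of_ne {g h x y z : ℕ} (hx : x < 7) (hy : y < 7) (hz : z < 7)
    (hgh : g ≠ h) : block g (triMask h x y z) = 0 := by
  simp [triMask, block_xor, block_edgeMask_of_ne, hx, hy, hz, hgh]

theorem dual0_lt (u a b c : ℕ) : dual0 u a b c < 7 := Nat.mod_lt _ (by norm_num)

theorem dual1_lt (a b c : ℕ) : dual1 a b c < 7 := Nat.mod_lt _ (by norm_num)

theorem dual2_lt (b c : ℕ) : dual2 b c < 7 := Nat.mod_lt _ (by norm_num)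

theorem dual0_dual {u : ℕ} (hu : u < 7) (a b c : ℕ) :
    dual0 (dual0 u a b c) (dual1 a b c) (dual2 b c) c = u := by
  unfold dual0 dual1 dual2; omega

theorem dual1_dual {a : ℕ} (ha : a < 7) (b c : ℕ) :
    dual1 (dual1 a b c) (dual2 b c) c = a := by
  unfold dual1 dual2; omega

theorem dual2_dual {b : ℕ} (hb : b < 7) (c : ℕ) : dual2 (dual2 b c) c = b := by
  unfold dual2; omega

/-- The masks of the nondegenerate terms `(u; a, b, c)`. -/
def IsTermMask (μ : ℕ) : Prop :=
  ∃ u a b c, u < 7 ∧ a < 7 ∧ b < 7 ∧ c < 7 ∧ a ≠ b ∧ b ≠ c ∧ μ = termMask u a b c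

theorem block_termMask {u a b c g : ℕ} (hg : g < 7) (ha : a < 7) (hb : b < 7)
    (hc : c < 7) : block g (termMask u a b c) = if g = u then triMask 0 a b c else 0 := by
  have h := dual0_lt u a b c
  rw [termMask, block_xor, block_triMask_of_ne (dual1_lt _ _ _) (dual2_lt _ _) hc (by omega)]
  split_ifs with hgu
  · rw [hgu, block_triMask_self _ ha hb hc, Nat.xor_zero]
  · rw [block_triMask_of_ne ha hb hc hgu, Nat.xor_zero]

theorem block_termMask_dual {u a b c : ℕ} (g : ℕ) (hu : u < 7) (ha : a < 7) (hb : b < 7)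
    (hc : c < 7) : block (7 + g) (termMask u a b c) =
      if g = dual0 u a b c then triMask 0 (dual1 a b c) (dual2 b c) c else 0 := by
  rw [termMask, block_xor, block_triMask_of_ne ha hb hc (by omega), Nat.zero_xor]
  split_ifs with hgu
  · rw [hgu, block_triMask_self _ (dual1_lt _ _ _) (dual2_lt _ _) hc]
  · rw [block_triMask_of_ne (dual1_lt _ _ _) (dual2_lt _ _) hc (by omega)]

theorem dropBit_triMask : ∀ x < 7, ∀ y < 7, ∀ z < 7,
    dropBit (dropBit (dropBit (triMask 0 x y z))) = 0 := by
  decide +kernel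

theorem dropBit_bigon : ∀ x < 7, ∀ y < 7, dropBit (dropBit (triMask 0 x y x)) = 0 := by
  decide +kernel

theorem triMask_inj {x y z x' y' z' : ℕ} (hx : x < 7) (hy : y < 7) (hz : z < 7)
    (hx' : x' < 7) (hy' : y' < 7) (hz' : z' < 7) (hxy : x ≠ y) (hyz : y ≠ z)
    (hd : dropBit (dropBit (triMask 0 x y z)) ≠ 0)
    (h : triMask 0 x y z = triMask 0 x' y' z') : x = x' ∧ y = y' ∧ z = z' := by
  have hxz : x ≠ z := by
    rintro rfl
    exact hd (dropBit_bigon x hx y hy)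
  have key : ∀ k, k = 7 * x + y ∨ k = 7 * x + z ∨ k = 7 * y + z →
      (triMask 0 x' y' z').testBit k = true := by
    intro k hk
    rw [← h]
    simp only [triMask, Nat.testBit_xor, testBit_edgeMask]
    rcases hk with hk | hk | hk
    · rw [decide_eq_true (by omega), decide_eq_false (by omega), decide_eq_false (by omega)]; rfl
    · rw [decide_eq_false (by omega), decide_eq_true (by omega), decide_eq_false (by omega)]; rfl
    · rw [decide_eq_false (by omega), decide_eq_false (by omega), decide_eq_true (by omega)]; rfl
  have h1 := edge_of_testBit_triMask (key _ (Or.inl rfl))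
  have h2 := edge_of_testBit_triMask (key _ (Or.inr (Or.inl rfl)))
  have h3 := edge_of_testBit_triMask (key _ (Or.inr (Or.inr rfl)))
  omega

theorem dual_ne {a b c : ℕ} (ha : a < 7) (hb : b < 7) (hc : c < 7) (hab : a ≠ b) (hbc : b ≠ c) :
    dual1 a b c ≠ dual2 b c ∧ dual2 b c ≠ c := by
  unfold dual1 dual2; omega

/-- A term is determined by one block of its mask, unless that block is a bigon. -/
theorem term_eq_of_block_eq {u a b c u' a' b' c' g : ℕ} (hg : g < 14) (hu : u < 7) (ha : a < 7)
    (hb : b < 7) (hc : c < 7) (hu' : u' < 7) (ha' : a' < 7) (hb' : b' < 7) (hc' : c' < 7)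
    (hab : a ≠ b) (hbc : b ≠ c)
    (hd : dropBit (dropBit (block g (termMask u a b c))) ≠ 0)
    (h : block g (termMask u a b c) = block g (termMask u' a' b' c')) :
    u = u' ∧ a = a' ∧ b = b' ∧ c = c' := by
  have hz : dropBit (dropBit 0) = 0 := rfl
  rcases lt_or_ge g 7 with hg7 | hg7
  · rw [block_termMask hg7 ha hb hc] at h hd
    rw [block_termMask hg7 ha' hb' hc'] at h
    split_ifs at h hd with h1 h2
    · obtain ⟨e1, e2, e3⟩ := triMask_inj ha hb hc ha' hb' hc' hab hbc hd h
      exact ⟨h1 ▸ h2, e1, e2, e3⟩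
    · rw [h] at hd; exact absurd hz hd
    all_goals exact absurd hz hd
  · obtain ⟨g, rfl⟩ := Nat.exists_eq_add_of_le hg7
    rw [block_termMask_dual g hu ha hb hc] at h hd
    rw [block_termMask_dual g hu' ha' hb' hc'] at h
    obtain ⟨n1, n2⟩ := dual_ne ha hb hc hab hbc
    split_ifs at h hd with h1 h2
    · obtain ⟨e1, e2, e3⟩ := triMask_inj (dual1_lt _ _ _) (dual2_lt _ _) hc (dual1_lt _ _ _)
        (dual2_lt _ _) hc' n1 n2 hd h
      have e0 : dual0 u a b c = dual0 u' a' b' c' := h1 ▸ h2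
      refine ⟨?_, ?_, ?_, e3⟩
      · rw [← dual0_dual hu a b c, e0, e1, e2, e3, dual0_dual hu']
      · rw [← dual1_dual ha b c, e1, e2, e3, dual1_dual ha']
      · rw [← dual2_dual hb c, e2, e3, dual2_dual hb']
    · rw [h] at hd; exact absurd hz hd
    all_goals exact absurd hz hd

theorem termMask_inj {u a b c u' a' b' c' : ℕ} (hu : u < 7) (ha : a < 7)
    (hb : b < 7) (hc : c < 7) (hu' : u' < 7) (ha' : a' < 7) (hb' : b' < 7) (hc' : c' < 7)
    (hab : a ≠ b) (hbc : b ≠ c) (h : termMask u a b c = termMask u' a' b' c') :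
    u = u' ∧ a = a' ∧ b = b' ∧ c = c' := by
  have hn : ∀ x < 7, ∀ y < 7, ∀ z < 7, x = y ∨ y = z ∨ x = z ∨
      dropBit (dropBit (triMask 0 x y z)) ≠ 0 := by decide +kernel
  obtain ⟨n1, n2⟩ := dual_ne ha hb hc hab hbc
  by_cases hac : a = c
  · refine term_eq_of_block_eq (g := 7 + dual0 u a b c) ?_ hu ha hb hc hu' ha' hb' hc' hab hbc ?_
      (by rw [h])
    · have := dual0_lt u a b c; omega
    · rw [block_termMask_dual _ hu ha hb hc, if_pos rfl]
      have := hn _ (dual1_lt a b c) _ (dual2_lt b c) _ hc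
      have n3 : dual1 a b c ≠ c := by unfold dual1; omega
      tauto
  · refine term_eq_of_block_eq (g := u) (by omega) hu ha hb hc hu' ha' hb' hc' hab hbc ?_
      (by rw [h])
    rw [block_termMask hu ha hb hc, if_pos rfl]
    have := hn _ ha _ hb _ hc
    tauto

theorem IsTermMask.dropBit_block {μ : ℕ} (h : IsTermMask μ) {g : ℕ} :
    dropBit (dropBit (dropBit (block g μ))) = 0 := by
  obtain ⟨u, a, b, c, hu, ha, hb, hc, -, -, rfl⟩ := h
  rcases lt_or_ge g 7 with hg | hg
  · rw [block_termMask hg ha hb hc]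
    split_ifs
    exacts [dropBit_triMask _ ha _ hb _ hc, rfl]
  · obtain ⟨g, rfl⟩ := Nat.exists_eq_add_of_le hg
    rw [block_termMask_dual g hu ha hb hc]
    split_ifs
    exacts [dropBit_triMask _ (dual1_lt _ _ _) _ (dual2_lt _ _) _ hc, rfl]

theorem IsTermMask.eq_of_block_eq {μ ν : ℕ} (hμ : IsTermMask μ) (hν : IsTermMask ν) {g : ℕ}
    (hg : g < 14) (hd : dropBit (dropBit (block g μ)) ≠ 0) (h : block g μ = block g ν) :
    μ = ν := by
  obtain ⟨u, a, b, c, hu, ha, hb, hc, hab, hbc, rfl⟩ := hμ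
  obtain ⟨u', a', b', c', hu', ha', hb', hc', -, -, rfl⟩ := hν
  obtain ⟨rfl, rfl, rfl, rfl⟩ :=
    term_eq_of_block_eq hg hu ha hb hc hu' ha' hb' hc' hab hbc hd h
  rfl

/-- Among the blocks `0, …, 6`, and among `7, …, 13`, a mask has at most one nonzero block. -/
theorem IsTermMask.card_blocks_le {μ : ℕ} (h : IsTermMask μ) {off : ℕ}
    (hoff : off = 0 ∨ off = 7) :
    ((Finset.range 7).filter fun i => block (off + i) μ ≠ 0).card ≤ 1 := by
  obtain ⟨u, a, b, c, hu, ha, hb, hc, -, -, rfl⟩ := h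
  rw [Finset.card_le_one]
  intro i hi j hj
  rw [Finset.mem_filter, Finset.mem_range] at hi hj
  rcases hoff with rfl | rfl
  · rw [Nat.zero_add, block_termMask hi.1 ha hb hc] at hi
    rw [Nat.zero_add, block_termMask hj.1 ha hb hc] at hj
    rw [(ite_ne_right_iff.1 hi.2).1, (ite_ne_right_iff.1 hj.2).1]
  · rw [block_termMask_dual i hu ha hb hc] at hi
    rw [block_termMask_dual j hu ha hb hc] at hj
    rw [(ite_ne_right_iff.1 hi.2).1, (ite_ne_right_iff.1 hj.2).1]

theorem allBranches_spec {P : ℕ → Bool} {g x y n : ℕ} (h : allBranches P g x y n = true) :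
    ∀ z < n, (y ≠ z → P (blockMask g x y z) = true) ∧ (x ≠ z → P (blockMask g z x y) = true) ∧
      (x ≠ z → z ≠ y → P (blockMask g x z y) = true) := by
  induction n with
  | zero => intro z hz; omega
  | succ n ih =>
    simp only [allBranches, Bool.and_eq_true, Bool.or_eq_true, Nat.beq_eq] at h
    obtain ⟨⟨⟨h1, h2⟩, h3⟩, h4⟩ := h
    intro z hz
    rcases Nat.lt_succ_iff_lt_or_eq.1 hz with hz | rfl
    · exact ih h4 z hz
    · tauto

theorem allBranches_triangle {P : ℕ → Bool} {g x y z k : ℕ}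
    (h : allBranches P (k / 49) (k / 7 % 7) (k % 7) 7 = true) (hx : x < 7) (hy : y < 7)
    (hz : z < 7) (hxy : x ≠ y) (hyz : y ≠ z) (hk : (triMask g x y z).testBit k = true) :
    P (blockMask g x y z) = true := by
  have hs := allBranches_spec h
  rcases edge_of_testBit_triMask hk with ⟨-, rfl⟩ | ⟨-, rfl⟩ | ⟨-, rfl⟩
  · have e1 : (49 * g + 7 * x + y) / 49 = g := by omega
    have e2 : (49 * g + 7 * x + y) / 7 % 7 = x := by omega
    have e3 : (49 * g + 7 * x + y) % 7 = y := by omega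
    rw [e1, e2, e3] at hs
    exact (hs z hz).1 hyz
  · have e1 : (49 * g + 7 * x + z) / 49 = g := by omega
    have e2 : (49 * g + 7 * x + z) / 7 % 7 = x := by omega
    have e3 : (49 * g + 7 * x + z) % 7 = z := by omega
    rw [e1, e2, e3] at hs
    exact (hs y hy).2.2 hxy hyz
  · have e1 : (49 * g + 7 * y + z) / 49 = g := by omega
    have e2 : (49 * g + 7 * y + z) / 7 % 7 = y := by omega
    have e3 : (49 * g + 7 * y + z) % 7 = z := by omega
    rw [e1, e2, e3] at hs
    exact (hs x hx).2.1 hxy.symm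

theorem IsTermMask.of_allBranches {P : ℕ → Bool} {μ k : ℕ} (hμ : IsTermMask μ)
    (h : allBranches P (k / 49) (k / 7 % 7) (k % 7) 7 = true) (hk : μ.testBit k = true) :
    P μ = true := by
  obtain ⟨u, a, b, c, hu, ha, hb, hc, hab, hbc, rfl⟩ := hμ
  obtain ⟨n1, n2⟩ := dual_ne ha hb hc hab hbc
  by_cases hf : (triMask u a b c).testBit k = true
  · have := allBranches_triangle h ha hb hc hab hbc hf
    have e : Nat.ble 7 u = false := by
      rw [Bool.eq_false_iff, Ne, Nat.ble_eq]; omega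
    rwa [blockMask, e, cond_false] at this
  · have hg : (triMask (7 + dual0 u a b c) (dual1 a b c) (dual2 b c) c).testBit k = true := by
      rw [termMask, Nat.testBit_xor] at hk
      simpa [hf] using hk
    have := allBranches_triangle h (dual1_lt _ _ _) (dual2_lt _ _) hc n1 n2 hg
    rwa [blockMask, Nat.ble_eq_true_of_le (by omega), cond_true, Nat.add_sub_cancel_left,
      dual0_dual hu, dual1_dual ha, dual2_dual hb] at this

/-- `m` is the sum modulo 2 of the masks in `L`. -/
def IsXor (m : ℕ) (L : Finset ℕ) : Prop :=
  ∀ k, m.testBit k = true ↔ Odd (L.filter fun μ => μ.testBit k = true).card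

theorem IsXor.testBit_block {m : ℕ} {L : Finset ℕ} (h : IsXor m L) (g j : ℕ) :
    (block g m).testBit j = true ↔
      Odd ((L.filter fun μ => block g μ ≠ 0).filter fun μ => (block g μ).testBit j = true).card := by
  have hne : ∀ μ, (block g μ).testBit j = true → block g μ ≠ 0 := by
    intro μ h1 h2; simp [h2] at h1
  rw [Finset.filter_filter, Finset.filter_congr (q := fun μ => (block g μ).testBit j = true)
    (fun μ _ => ⟨And.right, fun h1 => ⟨hne μ h1, h1⟩⟩)]
  by_cases hj : j < 49
  · simp only [QHom.testBit_block, hj, decide_true, Bool.true_and]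
    exact h _
  · simp [QHom.testBit_block, hj]

theorem weight_le {used : List ℕ} {m g : ℕ} {L : Finset ℕ} (hg : g < 14)
    (hL : ∀ μ ∈ L, IsTermMask μ) (hu : ∀ μ ∈ used, IsTermMask μ) (hd : ∀ μ ∈ L, μ ∉ used)
    (h : IsXor m L) :
    weight used g (block g m) ≤ (L.filter fun μ => block g μ ≠ 0).card := by
  have hb := h.testBit_block g
  set A := L.filter fun μ => block g μ ≠ 0 with hA
  rcases Nat.lt_or_ge A.card 2 with hc | hc
  · rcases Nat.lt_succ_iff_lt_or_eq.1 hc with hc | hc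
    · have hA0 : A = ∅ := by rw [← Finset.card_eq_zero]; omega
      have : block g m = 0 := by
        apply Nat.eq_of_testBit_eq
        intro j
        rw [Nat.zero_testBit, Bool.eq_false_iff, Ne, hb j, hA0]
        simp
      rw [this]
      exact Nat.zero_le _
    · obtain ⟨μ, hμ⟩ := Finset.card_eq_one.1 hc
      have hμL : μ ∈ L := Finset.mem_of_mem_filter μ (by rw [← hA, hμ]; simp)
      have hm : block g m = block g μ := by
        apply Nat.eq_of_testBit_eq
        intro j
        rw [Bool.eq_iff_iff, hb j, hμ, Finset.filter_singleton]
        split_ifs with h1 <;> simp [h1]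
      rw [hc, hm, weight, (hL μ hμL).dropBit_block]
      rcases Bool.eq_false_or_eq_true (Nat.beq (block g μ) 0) with h1 | h1 <;> rw [h1]
      · exact Nat.zero_le _
      rcases Bool.eq_false_or_eq_true (Nat.beq (dropBit (dropBit (block g μ))) 0) with h2 | h2 <;>
        rw [h2]
      · exact le_rfl
      have h3 : (used.any fun ν => Nat.beq (block g ν) (block g μ)) = false := by
        rw [List.any_eq_false]
        intro ν hν h4
        rw [Nat.beq_eq] at h4
        rw [(hL μ hμL).eq_of_block_eq (hu ν hν) hg (natBeq_eq_false.1 h2) h4.symm] at hμL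
        exact hd ν hμL hν
      rw [h3]
      exact le_rfl
  · refine le_trans ?_ hc
    simp only [weight, cond_eq_ite]
    split_ifs <;> omega

theorem load_le {used : List ℕ} {m off : ℕ} {L : Finset ℕ} (hoff : off = 0 ∨ off = 7)
    (hL : ∀ μ ∈ L, IsTermMask μ) (hu : ∀ μ ∈ used, IsTermMask μ) (hd : ∀ μ ∈ L, μ ∉ used)
    (h : IsXor m L) : load used m off 7 ≤ L.card := by
  have h1 : ∀ n ≤ 7, load used m off n ≤
      ∑ i ∈ Finset.range n, (L.filter fun μ => block (off + i) μ ≠ 0).card := by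
    intro n
    induction n with
    | zero => intro _; exact le_rfl
    | succ n ih =>
      intro hn
      rw [Finset.sum_range_succ, load, Nat.add_comm]
      exact Nat.add_le_add (ih (by omega)) (weight_le (by omega) hL hu hd h)
  refine (h1 7 le_rfl).trans ?_
  simp only [Finset.card_filter]
  rw [Finset.sum_comm, Finset.card_eq_sum_ones]
  refine Finset.sum_le_sum fun μ hμ => ?_
  rw [← Finset.card_filter]
  exact (hL μ hμ).card_blocks_le hoff

theorem IsXor.erase {m μ : ℕ} {L : Finset ℕ} (h : IsXor m L) (hμ : μ ∈ L) :
    IsXor (m ^^^ μ) (L.erase μ) := by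
  intro k
  rw [Nat.testBit_xor, Finset.filter_erase]
  by_cases hk : μ.testBit k = true
  · have hmem : μ ∈ L.filter fun ν => ν.testBit k = true := Finset.mem_filter.2 ⟨hμ, hk⟩
    have hcard := Finset.card_erase_add_one hmem
    have := h k
    rw [← hcard, Nat.odd_add_one] at this
    rw [hk, Bool.xor_true, Bool.not_eq_true', Bool.eq_false_iff, Ne, this, not_not]
  · rw [Finset.erase_eq_of_notMem (by simp [hk]), ← h k]
    simp [hk]

theorem not_isXor_of_search {r : ℕ} : ∀ {m : ℕ} {used : List ℕ} {L : Finset ℕ},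
    search r m used = true → (∀ μ ∈ L, IsTermMask μ) → (∀ μ ∈ used, IsTermMask μ) →
    (∀ μ ∈ L, μ ∉ used) → L.card ≤ r → ¬ IsXor m L := by
  induction r with
  | zero =>
    intro m used L hs _ _ _ hc h
    rw [search, Bool.not_eq_true', natBeq_eq_false] at hs
    obtain ⟨k, hk⟩ := Nat.exists_testBit_of_ne_zero hs
    rw [h k, Finset.card_eq_zero.1 (Nat.le_zero.1 hc)] at hk
    simp at hk
  | succ r ih =>
    intro m used L hs hL hu hd hc h
    have hb0 := (load_le (Or.inl rfl) hL hu hd h).trans hc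
    have hb7 := (load_le (Or.inr rfl) hL hu hd h).trans hc
    rw [search, Nat.ble_eq_true_of_le hb0, Nat.ble_eq_true_of_le hb7, Bool.not_true,
      Bool.false_or, Bool.false_or, Bool.and_eq_true, Bool.not_eq_true',
      natBeq_eq_false] at hs
    obtain ⟨hm, hs⟩ := hs
    have hk : Odd (L.filter fun μ => μ.testBit (Nat.log2 m) = true).card :=
      (h _).1 (Nat.testBit_log2 hm)
    obtain ⟨μ, hμ⟩ := Finset.card_pos.1 hk.pos
    rw [Finset.mem_filter] at hμ
    have hP := (hL μ hμ.1).of_allBranches hs hμ.2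
    rw [Bool.or_eq_true] at hP
    rcases hP with hP | hP
    · obtain ⟨ν, hν, he⟩ := List.any_eq_true.1 hP
      rw [Nat.beq_eq] at he
      exact hd μ hμ.1 (he ▸ hν)
    · refine ih hP (fun ν hν => hL ν (Finset.mem_of_mem_erase hν)) ?_ ?_ ?_ (h.erase hμ.1)
      · intro ν hν
        rcases List.mem_cons.1 hν with rfl | hν
        exacts [hL _ hμ.1, hu ν hν]
      · intro ν hν hν'
        rcases List.mem_cons.1 hν' with rfl | hν'
        exacts [Finset.notMem_erase _ _ hν, hd ν (Finset.mem_of_mem_erase hν) hν']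
      · rw [Finset.card_erase_of_mem hμ.1]; omega

theorem search_bigon_start : search 6 (termMask 0 0 1 0) [termMask 0 0 1 0] = true := by
  decide +kernel

/-- The tuples `(u; a, b, c)`. -/
abbrev Term := ZMod 7 × ZMod 7 × ZMod 7 × ZMod 7

/-- The coefficient modulo 2 of `(w; x, y)` in the boundary of the triangle `(u; a, b, c)`,
for `x ≠ y`. -/
def edgeCoeff : Term → ZMod 7 → ZMod 7 → ZMod 7 → ZMod 2
  | (u, a, b, c), w, x, y =>
    if u = w then
      (if a = x ∧ b = y then 1 else 0) + (if a = x ∧ c = y then 1 else 0) +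
        (if b = x ∧ c = y then 1 else 0)
    else 0

/-- The triangle whose boundary is the `g`-boundary of a tuple, up to a change of labels. -/
def dualTerm : Term → Term
  | (u, a, b, c) => (6 * u + 2 * a + 5 * b + 2 * c, a + 5 * b + 2 * c, 6 * b + 2 * c, c)

/-- No two consecutive quandle entries coincide. -/
def Nondeg : Term → Prop
  | (_, a, b, c) => a ≠ b ∧ b ≠ c

/-- The sum of the triangles `τ t`, for `t ∈ S`, has no boundary modulo 2. -/
def IsClosed₂ (S : Finset Term) (τ : Term → Term) : Prop :=
  ∀ w x y, x ≠ y → ∑ t ∈ S, edgeCoeff (τ t) w x y = 0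

/-- The mask of a tuple. -/
def mask : Term → ℕ
  | (u, a, b, c) => termMask u.val a.val b.val c.val

theorem dualTerm_val (u a b c : ZMod 7) :
    dual0 u.val a.val b.val c.val = (6 * u + 2 * a + 5 * b + 2 * c).val ∧
      dual1 a.val b.val c.val = (a + 5 * b + 2 * c).val ∧
      dual2 b.val c.val = (6 * b + 2 * c).val := by
  refine ⟨?_, ?_, ?_⟩ <;> simp only [dual0, dual1, dual2] <;> rw [← ZMod.val_natCast] <;>
    push_cast <;> simp only [ZMod.natCast_zmod_val]

theorem val_ne_val {x y : ZMod 7} (h : x ≠ y) : x.val ≠ y.val :=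
  fun h' => h (ZMod.val_injective 7 h')

theorem isTermMask_mask {t : Term} (h : Nondeg t) : IsTermMask (mask t) := by
  obtain ⟨u, a, b, c⟩ := t
  exact ⟨_, _, _, _, u.val_lt, a.val_lt, b.val_lt, c.val_lt, val_ne_val h.1, val_ne_val h.2, rfl⟩

theorem mask_inj {t t' : Term} (ht : Nondeg t) (h : mask t = mask t') : t = t' := by
  obtain ⟨u, a, b, c⟩ := t
  obtain ⟨u', a', b', c'⟩ := t'
  obtain ⟨h1, h2, h3, h4⟩ := termMask_inj u.val_lt a.val_lt b.val_lt c.val_lt u'.val_lt a'.val_lt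
    b'.val_lt c'.val_lt (val_ne_val ht.1) (val_ne_val ht.2) h
  rw [ZMod.val_injective 7 h1, ZMod.val_injective 7 h2, ZMod.val_injective 7 h3,
    ZMod.val_injective 7 h4]

/-- A bit of a natural number, as an element of `ZMod 2`. -/
def bit₂ (m k : ℕ) : ZMod 2 := if m.testBit k = true then 1 else 0

theorem bit₂_xor (m n k : ℕ) : bit₂ (m ^^^ n) k = bit₂ m k + bit₂ n k := by
  simp only [bit₂, Nat.testBit_xor]
  cases m.testBit k <;> cases n.testBit k <;> rfl

theorem bit₂_edgeMask (off k : ℕ) (u x y : ZMod 7) :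
    bit₂ (edgeMask (off + u.val) x.val y.val) k =
      if ((k / 7 : ℕ) : ZMod 7) ≠ (k : ZMod 7) ∧ off ≤ k / 49 ∧ k / 49 - off < 7 then
        if u = ((k / 49 - off : ℕ) : ZMod 7) ∧ x = ((k / 7 : ℕ) : ZMod 7) ∧ y = (k : ZMod 7)
        then 1 else 0
      else 0 := by
  have hx := x.val_lt
  have hy := y.val_lt
  have hu := u.val_lt
  have key : ∀ (z : ZMod 7) (n : ℕ), z = (n : ZMod 7) ↔ z.val = n % 7 := by
    intro z n
    rw [← ZMod.val_natCast, (ZMod.val_injective 7).eq_iff]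
  have key' : ((k / 7 : ℕ) : ZMod 7) = (k : ZMod 7) ↔ k / 7 % 7 = k % 7 := by
    rw [key, ZMod.val_natCast]
  rw [← ite_and]
  simp only [bit₂, testBit_edgeMask, decide_eq_true_eq, Ne, key']
  simp only [key]
  refine if_congr ⟨?_, ?_⟩ rfl rfl
  · rintro ⟨h, rfl⟩
    have h' : (49 * (off + u.val) + 7 * x.val + y.val) / 7 = 7 * (off + u.val) + x.val := by omega
    rw [h']
    omega
  · rintro ⟨⟨h1, h2, h3⟩, h4, h5, h6⟩
    omega

theorem bit₂_triMask (off k : ℕ) (u a b c : ZMod 7) :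
    bit₂ (triMask (off + u.val) a.val b.val c.val) k =
      if ((k / 7 : ℕ) : ZMod 7) ≠ (k : ZMod 7) ∧ off ≤ k / 49 ∧ k / 49 - off < 7 then
        edgeCoeff (u, a, b, c) ((k / 49 - off : ℕ) : ZMod 7) ((k / 7 : ℕ) : ZMod 7) (k : ZMod 7)
      else 0 := by
  simp only [triMask, bit₂_xor, bit₂_edgeMask, edgeCoeff]
  split_ifs <;> simp_all

theorem bit₂_mask (t : Term) (k : ℕ) : bit₂ (mask t) k =
    (if ((k / 7 : ℕ) : ZMod 7) ≠ (k : ZMod 7) ∧ 0 ≤ k / 49 ∧ k / 49 - 0 < 7 then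
      edgeCoeff t ((k / 49 - 0 : ℕ) : ZMod 7) ((k / 7 : ℕ) : ZMod 7) (k : ZMod 7) else 0) +
    (if ((k / 7 : ℕ) : ZMod 7) ≠ (k : ZMod 7) ∧ 7 ≤ k / 49 ∧ k / 49 - 7 < 7 then
      edgeCoeff (dualTerm t) ((k / 49 - 7 : ℕ) : ZMod 7) ((k / 7 : ℕ) : ZMod 7) (k : ZMod 7)
      else 0) := by
  obtain ⟨u, a, b, c⟩ := t
  obtain ⟨h0, h1, h2⟩ := dualTerm_val u a b c
  have h := bit₂_triMask 0 k u a b c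
  rw [Nat.zero_add] at h
  rw [mask, termMask, bit₂_xor, h0, h1, h2, h, bit₂_triMask]
  rfl

theorem isXor_zero_image_mask {S : Finset Term} (hS : ∀ t ∈ S, Nondeg t)
    (hf : IsClosed₂ S id) (hg : IsClosed₂ S dualTerm) : IsXor 0 (S.image mask) := by
  intro k
  have hsum : ((((S.image mask).filter fun μ => μ.testBit k = true).card : ℕ) : ZMod 2) = 0 := by
    rw [Finset.card_filter, Nat.cast_sum, Finset.sum_image fun t ht t' _ h => mask_inj (hS t ht) h]
    simp only [Nat.cast_ite, Nat.cast_one, Nat.cast_zero]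
    change ∑ t ∈ S, bit₂ (mask t) k = 0
    simp only [bit₂_mask, Finset.sum_add_distrib]
    have h1 := fun h => hf ((k / 49 - 0 : ℕ) : ZMod 7) ((k / 7 : ℕ) : ZMod 7) (k : ZMod 7) h
    have h2 := fun h => hg ((k / 49 - 7 : ℕ) : ZMod 7) ((k / 7 : ℕ) : ZMod 7) (k : ZMod 7) h
    simp only [id] at h1
    split_ifs <;> simp_all
  rw [Nat.zero_testBit, ← Nat.not_even_iff_odd, ← ZMod.natCast_eq_zero_iff_even]
  simp [hsum]

theorem not_mem_of_isClosed₂ {S : Finset Term} (hS : ∀ t ∈ S, Nondeg t)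
    (hf : IsClosed₂ S id) (hg : IsClosed₂ S dualTerm) (hc : S.card ≤ 7) :
    (0, 0, 1, 0) ∉ S := by
  intro hu
  have hμ := Finset.mem_image_of_mem mask hu
  have hX := (isXor_zero_image_mask hS hf hg).erase hμ
  rw [Nat.zero_xor] at hX
  have hL : ∀ μ ∈ S.image mask, IsTermMask μ := by
    intro μ hμ
    obtain ⟨t, ht, rfl⟩ := Finset.mem_image.1 hμ
    exact isTermMask_mask (hS t ht)
  refine not_isXor_of_search search_bigon_start
    (fun μ hμ => hL μ (Finset.mem_of_mem_erase hμ)) ?_ ?_ ?_ hX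
  · intro μ h
    rw [List.mem_singleton.1 h]
    exact hL _ hμ
  · intro μ h h'
    exact Finset.ne_of_mem_erase h (List.mem_singleton.1 h')
  · have := Finset.card_image_le (s := S) (f := mask)
    rw [Finset.card_erase_of_mem hμ]
    omega

/-- The action on tuples of a map of indices and a map of quandle entries. -/
def mapTerm (ρ ψ : ZMod 7 → ZMod 7) : Term → Term
  | (u, a, b, c) => (ρ u, ψ a, ψ b, ψ c)

theorem edgeCoeff_mapTerm {ρ ψ : ZMod 7 → ZMod 7} (hρ : ρ.Injective) (hψ : ψ.Injective)
    (t : Term) (w x y : ZMod 7) :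
    edgeCoeff (mapTerm ρ ψ t) (ρ w) (ψ x) (ψ y) = edgeCoeff t w x y := by
  simp only [edgeCoeff, mapTerm, hρ.eq_iff, hψ.eq_iff]

theorem IsClosed₂.image_mapTerm {S : Finset Term} {τ : Term → Term} (h : IsClosed₂ S τ)
    {ρ ρ' ψ : ZMod 7 → ZMod 7} (hρ : ρ.Injective) (hρ' : ρ'.Bijective) (hψ : ψ.Bijective)
    (hτ : ∀ t, τ (mapTerm ρ ψ t) = mapTerm ρ' ψ (τ t)) :
    IsClosed₂ (S.image (mapTerm ρ ψ)) τ := by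
  intro w x y hxy
  obtain ⟨w, rfl⟩ := hρ'.2 w
  obtain ⟨x, rfl⟩ := hψ.2 x
  obtain ⟨y, rfl⟩ := hψ.2 y
  have hinj : Function.Injective (mapTerm ρ ψ) := by
    rintro ⟨u, a, b, c⟩ ⟨u', a', b', c'⟩ h
    simpa [mapTerm, hρ.eq_iff, hψ.1.eq_iff] using h
  rw [Finset.sum_image hinj.injOn]
  simp only [hτ, edgeCoeff_mapTerm hρ'.1 hψ.1]
  exact h w x y fun h => hxy (h ▸ rfl)

instance : Fact (Nat.Prime 7) := ⟨by norm_num⟩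

theorem bijective_mul_sub {κ : ZMod 7} (hκ : κ ≠ 0) (s : ZMod 7) :
    Function.Bijective fun x => κ * (x - s) :=
  Finite.injective_iff_bijective.1 fun _ _ h => sub_left_injective (mul_left_cancel₀ hκ h)

/-- A small set of tuples that is closed modulo 2 for `f` and `g` contains no `f`-bigon. -/
theorem fst_ne_last_of_isClosed₂ {S : Finset Term} (hS : ∀ t ∈ S, Nondeg t)
    (hf : IsClosed₂ S id) (hg : IsClosed₂ S dualTerm) (hc : S.card ≤ 7) {u a b c : ZMod 7}
    (ht : (u, a, b, c) ∈ S) : a ≠ c := by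
  rintro rfl
  have hab : b - a ≠ 0 := sub_ne_zero.2 (hS _ ht).1.symm
  set κ := (b - a)⁻¹ with hκ
  have hψ := bijective_mul_sub (inv_ne_zero hab)
  have h7 : (7 : ZMod 7) = 0 := rfl
  refine not_mem_of_isClosed₂ (S := S.image (mapTerm (fun x => κ * (x - u)) fun x => κ * (x - a)))
    ?_ (hf.image_mapTerm (hψ u).1 (hψ u) (hψ a) fun _ => rfl)
    (hg.image_mapTerm (hψ u).1 (hψ (6 * u + 9 * a)) (hψ a) ?_) (Finset.card_image_le.trans hc) ?_
  · intro t ht'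
    obtain ⟨⟨u', a', b', c'⟩, hmem, rfl⟩ := Finset.mem_image.1 ht'
    obtain ⟨h1, h2⟩ := hS _ hmem
    exact ⟨(hψ a).1.ne h1, (hψ a).1.ne h2⟩
  · rintro ⟨u', a', b', c'⟩
    simp only [dualTerm, mapTerm, Prod.mk.injEq]
    refine ⟨?_, ?_, ?_, trivial⟩
    · ring
    · linear_combination (-1 * κ * a) * h7
    · linear_combination (-1 * κ * a) * h7
  · refine Finset.mem_image.2 ⟨_, ht, ?_⟩
    simp [mapTerm, hκ, inv_mul_cancel₀ hab]

theorem sum_edgeCoeff (t : Term) : ∑ w, ∑ x, ∑ y, edgeCoeff t w x y = 1 := by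
  obtain ⟨u, a, b, c⟩ := t
  have h : ∀ p q : ZMod 7, ∑ x, ∑ y, (if p = x ∧ q = y then (1 : ZMod 2) else 0) = 1 := by
    intro p q
    simp [ite_and]
  have hsum : ∀ w, ∑ x, ∑ y, edgeCoeff (u, a, b, c) w x y = if u = w then 1 else 0 := by
    intro w
    by_cases huw : u = w
    · simp only [edgeCoeff, huw, if_true, Finset.sum_add_distrib, h]
      rfl
    · simp [edgeCoeff, huw]
  simp only [hsum, Finset.sum_ite_eq, Finset.mem_univ, if_true]

/-- A set of at most seven tuples that is closed modulo 2 for `f` and `g` has even size. -/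
theorem even_card_of_isClosed₂ {S : Finset Term} (hS : ∀ t ∈ S, Nondeg t)
    (hf : IsClosed₂ S id) (hg : IsClosed₂ S dualTerm) (hc : S.card ≤ 7) : Even S.card := by
  have hdiag : ∀ w x, ∑ t ∈ S, edgeCoeff t w x x = 0 := by
    refine fun w x => Finset.sum_eq_zero ?_
    rintro ⟨u, a, b, c⟩ ht
    have h1 := hS _ ht
    have h2 := fst_ne_last_of_isClosed₂ hS hf hg hc ht
    simp only [Nondeg] at h1
    have hne : ∀ {p q : ZMod 7}, p ≠ q → ¬ (p = x ∧ q = x) := fun h h' => h (h'.1.trans h'.2.symm)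
    simp [edgeCoeff, hne h1.1, hne h1.2, hne h2]
  rw [← ZMod.natCast_eq_zero_iff_even]
  calc (S.card : ZMod 2) = ∑ t ∈ S, ∑ w, ∑ x, ∑ y, edgeCoeff t w x y := by simp [sum_edgeCoeff]
    _ = ∑ w, ∑ x, ∑ y, ∑ t ∈ S, edgeCoeff t w x y := by
      rw [Finset.sum_comm]
      refine Finset.sum_congr rfl fun w _ => ?_
      rw [Finset.sum_comm]
      exact Finset.sum_congr rfl fun x _ => Finset.sum_comm
    _ = 0 := by
      refine Finset.sum_eq_zero fun w _ => Finset.sum_eq_zero fun x _ =>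
        Finset.sum_eq_zero fun y _ => ?_
      by_cases hxy : x = y
      · rw [hxy]; exact hdiag w y
      · exact hf w x y hxy


theorem gen_apply (s : S) (l : List X) (p : Gen X S) [Decidable ((s, l) = p.1)] :
    gen s l p = if (s, l) = p.1 then 1 else 0 := by
  classical
  unfold gen
  split_ifs with h h' h'
  · rw [show (⟨(s, l), h⟩ : Gen X S) = p from Subtype.ext h', Finsupp.single_eq_same]
  · exact Finsupp.single_eq_of_ne fun h'' => h' (congrArg Subtype.val h'').symm
  · have hp := p.2
    rw [← h'] at hp
    exact absurd hp h
  · rfl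

/-- The tuple obtained by forgetting the degree. -/
def toTerm (t : Gen (ZMod 7) (ℤ × ZMod 7)) : Term :=
  (t.1.1.2, t.1.2.getD 0 0, t.1.2.getD 1 0, t.1.2.getD 2 0)

section boundary

variable {t : Gen (ZMod 7) (ℤ × ZMod 7)}

theorem fOn_apply (hl : t.1.2.length = 3) (p : Gen (ZMod 7) (ℤ × ZMod 7)) {m : ℤ}
    {w x y : ZMod 7} (hp : p.1 = ((m, w), [x, y])) :
    ((fOn t p : ℤ) : ZMod 2) = if t.1.1.1 = m then edgeCoeff (toTerm t) w x y else 0 := by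
  obtain ⟨⟨⟨n, u⟩, l⟩, h⟩ := t
  obtain ⟨a, b, c, rfl⟩ := List.length_eq_three.1 hl
  have hsum : fOn (⟨((n, u), [a, b, c]), h⟩ : Gen (ZMod 7) (ℤ × ZMod 7)) =
      ∑ j : Fin 3, ((-1 : ℤ) ^ ((j : ℕ) + 1)) • gen (n, u) ([a, b, c].eraseIdx (j : ℕ)) := rfl
  have h1 : (-1 : ZMod 2) = 1 := rfl
  rw [hsum, Fin.sum_univ_three]
  simp only [Finsupp.add_apply, Finsupp.smul_apply, gen_apply, hp]
  simp [h1, toTerm, edgeCoeff, ite_and]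
  split_ifs <;> simp_all

theorem gOn_apply (hl : t.1.2.length = 3) (p : Gen (ZMod 7) (ℤ × ZMod 7)) {m : ℤ}
    {w x y : ZMod 7} (hp : p.1 = ((m, 2 * y - 2 * x + w), [2 * y - x, y])) :
    ((gOn R7op (zact R7op) t p : ℤ) : ZMod 2) =
      if t.1.1.1 + 1 = m then edgeCoeff (dualTerm (toTerm t)) w x y else 0 := by
  obtain ⟨⟨⟨n, u⟩, l⟩, h⟩ := t
  obtain ⟨a, b, c, rfl⟩ := List.length_eq_three.1 hl
  have hsum : gOn R7op (zact R7op) (⟨((n, u), [a, b, c]), h⟩ : Gen (ZMod 7) (ℤ × ZMod 7)) =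
      gen (n + 1, R7op u a) [b, c] - gen (n + 1, R7op u b) [R7op a b, c] +
        gen (n + 1, R7op u c) [R7op a c, R7op b c] := by
    have : gOn R7op (zact R7op) (⟨((n, u), [a, b, c]), h⟩ : Gen (ZMod 7) (ℤ × ZMod 7)) =
      ∑ j : Fin 3, ((-1 : ℤ) ^ (j : ℕ)) •
      gen (zact R7op (n, u) ([a, b, c].get j))
        (([a, b, c].take (j : ℕ)).map (fun x => R7op x ([a, b, c].get j)) ++
          [a, b, c].drop ((j : ℕ) + 1)) := rfl
    rw [this, Fin.sum_univ_three]
    simp [zact, sub_eq_add_neg]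
  have h7 : (7 : ZMod 7) = 0 := rfl
  have hbc : 2 * a - u = 2 * y - 2 * x + w ∧ b = 2 * y - x ∧ c = y ↔
      6 * u + 2 * a + 5 * b + 2 * c = w ∧ 6 * b + 2 * c = x ∧ c = y := by
    constructor <;> rintro ⟨h1, h2, h3⟩ <;> refine ⟨?_, ?_, h3⟩
    · linear_combination h1 - 2 * h2 + 2 * h3 + (u + b) * h7
    · linear_combination 2 * h3 - h2 + b * h7
    · linear_combination h1 - 2 * h2 + 2 * h3 - (u - b) * h7
    · linear_combination 2 * h3 - h2 + b * h7
  have hac : 2 * b - u = 2 * y - 2 * x + w ∧ 2 * b - a = 2 * y - x ∧ c = y ↔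
      6 * u + 2 * a + 5 * b + 2 * c = w ∧ a + 5 * b + 2 * c = x ∧ c = y := by
    constructor <;> rintro ⟨h1, h2, h3⟩ <;> refine ⟨?_, ?_, h3⟩
    · linear_combination h1 - 2 * h2 + 2 * h3 + (u + b) * h7
    · linear_combination 2 * h3 - h2 + b * h7
    · linear_combination h1 - 2 * h2 + 2 * h3 - (u - b) * h7
    · linear_combination 2 * h3 - h2 + b * h7
  have hab : 2 * c - u = 2 * y - 2 * x + w ∧ 2 * c - a = 2 * y - x ∧ 2 * c - b = y ↔
      6 * u + 2 * a + 5 * b + 2 * c = w ∧ a + 5 * b + 2 * c = x ∧ 6 * b + 2 * c = y := by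
    constructor <;> rintro ⟨h1, h2, h3⟩ <;> refine ⟨?_, ?_, ?_⟩
    · linear_combination h1 - 2 * h2 + 2 * h3 + (u + b) * h7
    · linear_combination 2 * h3 - h2 + b * h7
    · linear_combination h3 + b * h7
    · linear_combination h1 - 2 * h2 + 2 * h3 - (u + b) * h7
    · linear_combination 2 * h3 - h2 - b * h7
    · linear_combination h3 - b * h7
  rw [hsum]
  simp only [Finsupp.add_apply, Finsupp.sub_apply, gen_apply, hp, R7op, Prod.mk.injEq,
    List.cons.injEq, and_true, and_assoc, hbc, hac, hab]
  simp only [toTerm, dualTerm, edgeCoeff, List.getD_cons_zero, List.getD_cons_succ, ite_and,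
    sub_eq_add_neg, Int.cast_add, Int.cast_neg, apply_ite (Int.cast : ℤ → ZMod 2), Int.cast_one,
    Int.cast_zero, ZMod.neg_eq_self_mod_two]
  split_ifs <;> simp_all

end boundary

theorem even_sum_natAbs_iff {α : Type*} (T : Finset α) (f : α → ℤ) :
    Even (∑ t ∈ T, (f t).natAbs) ↔ Even (T.filter fun t => Odd (f t)).card := by
  classical
  rw [← ZMod.natCast_eq_zero_iff_even, ← ZMod.natCast_eq_zero_iff_even, Finset.card_filter]
  push_cast
  have : ∀ t, (((f t).natAbs : ℕ) : ZMod 2) = if Odd (f t) then 1 else 0 := by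
    intro t
    split_ifs with h
    · rwa [ZMod.natCast_eq_one_iff_odd, Int.natAbs_odd]
    · rwa [ZMod.natCast_eq_zero_iff_even, Int.natAbs_even, ← Int.not_odd_iff_even]
  simp only [this]



theorem bd_apply (γ : Ch (ZMod 7) (ℤ × ZMod 7)) (p : Gen (ZMod 7) (ℤ × ZMod 7)) :
    ((bd R7op (zact R7op) γ p : ℤ) : ZMod 2) =
      ∑ t ∈ γ.support.filter (fun t => Odd (γ t)),
        (((fOn t p : ℤ) : ZMod 2) + ((gOn R7op (zact R7op) t p : ℤ) : ZMod 2)) := by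
  have hγ : ∀ t, ((γ t : ℤ) : ZMod 2) = if Odd (γ t) then 1 else 0 := by
    intro t
    split_ifs with h
    · exact (ZMod.intCast_eq_one_iff_odd).2 h
    · rwa [ZMod.intCast_eq_zero_iff_even, ← Int.not_odd_iff_even]
  rw [bd, fmap, gmap, Finsupp.sum, Finsupp.sum, Finset.sum_filter]
  simp only [Finsupp.add_apply, Finsupp.finsetSum_apply, Finsupp.smul_apply, smul_eq_mul,
    Int.cast_add, Int.cast_sum, Int.cast_mul, hγ, ite_mul, one_mul, zero_mul,
    ← Finset.sum_add_distrib]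
  refine Finset.sum_congr rfl fun t _ => ?_
  split_ifs <;> simp

theorem toTerm_injOn {T : Finset (Gen (ZMod 7) (ℤ × ZMod 7))} {n : ℤ}
    (hT : ∀ t ∈ T, t.1.2.length = 3 ∧ t.1.1.1 = n) : Set.InjOn toTerm T := by
  rintro ⟨⟨⟨k, u⟩, l⟩, h⟩ ht ⟨⟨⟨k', u'⟩, l'⟩, h'⟩ ht' htt'
  obtain ⟨hl, rfl⟩ := hT _ ht
  obtain ⟨hl', hk⟩ := hT _ ht'
  obtain ⟨a, b, c, rfl⟩ := List.length_eq_three.1 hl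
  obtain ⟨a', b', c', rfl⟩ := List.length_eq_three.1 hl'
  subst hk
  simpa [toTerm] using htt'

theorem nondeg_toTerm {t : Gen (ZMod 7) (ℤ × ZMod 7)} (hl : t.1.2.length = 3) :
    Nondeg (toTerm t) := by
  obtain ⟨⟨⟨k, u⟩, l⟩, h⟩ := t
  obtain ⟨a, b, c, rfl⟩ := List.length_eq_three.1 hl
  obtain ⟨hab, h⟩ := List.isChain_cons_cons.1 h
  exact ⟨hab, List.isChain_pair.1 h⟩

/-- there are no 3-cycles of `(R₇, ℤ × R₇)` of length `7` supported
in a single degree. -/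
theorem no_cycle_R7_length_seven_single_degree :
    ¬ ∃ (γ : Ch (ZMod 7) (ℤ × ZMod 7)) (n : ℤ),
        IsMChain 3 γ ∧ bd R7op (zact R7op) γ = 0 ∧ chainLen γ = 7 ∧
        MinDegree γ n ∧ Tcount γ n = 7 := by
  rintro ⟨γ, n, h3, hbd, hlen, -, hcount⟩
  have hdeg : ∀ t ∈ γ.support, t.1.1.1 = n := by
    have hle : ∀ t ∈ γ.support, (if t.1.1.1 = n then (γ t).natAbs else 0) ≤ (γ t).natAbs :=
      fun t _ => by split_ifs <;> simp
    intro t ht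
    have h := (Finset.sum_eq_sum_iff_of_le hle).1 (hcount.trans hlen.symm) t ht
    by_contra hn
    rw [if_neg hn, eq_comm, Int.natAbs_eq_zero] at h
    exact Finsupp.mem_support_iff.1 ht h
  set T := γ.support.filter fun t => Odd (γ t) with hTdef
  have hT : ∀ t ∈ T, t.1.2.length = 3 ∧ t.1.1.1 = n := fun t ht =>
    ⟨h3 t (Finset.mem_filter.1 ht).1, hdeg t (Finset.mem_filter.1 ht).1⟩
  have hinj := toTerm_injOn hT
  have hzero : ∀ p, ∑ t ∈ T,
      (((fOn t p : ℤ) : ZMod 2) + ((gOn R7op (zact R7op) t p : ℤ) : ZMod 2)) = 0 := fun p => by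
    rw [← bd_apply, hbd]; simp
  have hodd : ¬ Even T.card := by
    rw [hTdef, ← even_sum_natAbs_iff, show ∑ t ∈ γ.support, (γ t).natAbs = 7 from hlen]
    decide
  have hcard : T.card ≤ 7 := by
    refine (Finset.card_filter_le _ _).trans (le_of_le_of_eq ?_ hlen)
    rw [Finset.card_eq_sum_ones]
    exact Finset.sum_le_sum fun t ht => Int.natAbs_pos.2 (Finsupp.mem_support_iff.1 ht)
  rw [← Finset.card_image_of_injOn hinj] at hodd hcard
  refine hodd (even_card_of_isClosed₂ ?_ ?_ ?_ hcard)
  · intro s hs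
    obtain ⟨t, ht, rfl⟩ := Finset.mem_image.1 hs
    exact nondeg_toTerm (hT t ht).1
  · intro w x y hxy
    rw [Finset.sum_image hinj]
    refine (Finset.sum_congr rfl fun t ht => ?_).trans (hzero ⟨((n, w), [x, y]), List.isChain_pair.2 hxy⟩)
    rw [fOn_apply (hT t ht).1 _ rfl, gOn_apply (m := n) (w := w - 2 * y + 2 * (2 * y - x)) (x := 2 * y - x)
      (y := y) (hT t ht).1 _ (by ring_nf), (hT t ht).2]
    simp
  · intro w x y hxy
    have hne : 2 * y - x ≠ y := fun h => hxy (by linear_combination -h)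
    rw [Finset.sum_image hinj]
    refine (Finset.sum_congr rfl fun t ht => ?_).trans
      (hzero ⟨((n + 1, 2 * y - 2 * x + w), [2 * y - x, y]), List.isChain_pair.2 hne⟩)
    rw [fOn_apply (hT t ht).1 _ rfl, gOn_apply (hT t ht).1 _ rfl, (hT t ht).2]
    simp

end QHom
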